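/- Let G : D → Set(D) be an upper semicontinuous multivalued map on a nonempty bounded closed convex subset D of a Banach space, with nonempty closed convex values, such that G(D) is contained in a compact set. Then the set of fixed points {x ∈ D : x ∈ G(x)} is nonempty (Bohnenblust–Karlin). -/

import Mathlib

open Polynomial in
/-- Evaluation at `1` of polynomials of degree at most `n` is a fixed linear combination of
evaluations at points of `[0, δ)`. -/
lemma exists_extrapolation_nodes (n : ℕ) {δ : ℝ} (hδ : 0 < δ) :
    ∃ t c : Fin (n + 1) → ℝ, (∀ k, 0 ≤ t k ∧ t k < δ) ∧
      ∀ p : ℝ[X], p.natDegree ≤ n → p.eval 1 = ∑ k, c k * p.eval (t k) := by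
  let t : Fin (n + 1) → ℝ := fun k => δ * ((k : ℝ) / (n + 1))
  have ht : Function.Injective t := by
    intro i j hij
    have hn : (n : ℝ) + 1 ≠ 0 := by positivity
    have h : (i : ℝ) = (j : ℝ) := by
      simpa [t, hδ.ne', div_left_inj' hn] using hij
    exact Fin.ext (by exact_mod_cast h)
  refine ⟨t, fun k => (Lagrange.basis Finset.univ t k).eval 1, fun k => ⟨by positivity, ?_⟩, ?_⟩
  · have hk : (k : ℝ) / (n + 1) < 1 := by
      rw [div_lt_one (by positivity)]
      exact_mod_cast k.isLt
    simpa [t] using mul_lt_mul_of_pos_left hk hδ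
  · intro p hp
    have hdeg : p.degree < (Finset.univ : Finset (Fin (n + 1))).card := by
      rw [Finset.card_univ, Fintype.card_fin]
      exact (degree_le_of_natDegree_le hp).trans_lt (by exact_mod_cast Nat.lt_succ_self n)
    conv_lhs => rw [Lagrange.eq_interpolate ht.injOn hdeg, Lagrange.interpolate_apply,
      eval_finsetSum]
    simp [mul_comm]

open Polynomial in
/-- `t ↦ det (1 + t A)` is a polynomial of degree at most the dimension. -/
lemma ContinuousLinearMap.exists_polynomial_eval_eq_det_one_add_smul
    {E : Type*} [NormedAddCommGroup E] [NormedSpace ℝ E] [FiniteDimensional ℝ E] (A : E →L[ℝ] E) :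
    ∃ p : ℝ[X], p.natDegree ≤ Module.finrank ℝ E ∧ ∀ t : ℝ, (1 + t • A).det = p.eval t := by
  let b := Module.finBasis ℝ E
  let M := LinearMap.toMatrix b b (A : E →ₗ[ℝ] E)
  refine ⟨((X : ℝ[X]) • M.map C + (1 : Matrix _ _ ℝ).map C).det, ?_, fun t => ?_⟩
  · simpa using natDegree_det_X_add_C_le M 1
  · rw [ContinuousLinearMap.det, ← LinearMap.det_toMatrix b, ← coe_evalRingHom, RingHom.map_det]
    congr 1
    ext i j
    by_cases hij : i = j
    · simp [M, hij, LinearMap.toMatrix_apply, add_comm, mul_comm t]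
    · simp [M, hij, LinearMap.toMatrix_apply, mul_comm t]

open Metric in
/-- A function which is Lipschitz on a closed ball and vanishes on its boundary sphere extends by
zero to a Lipschitz function. -/
lemma LipschitzOnWith.indicator_closedBall {E F : Type*} [NormedAddCommGroup E] [NormedSpace ℝ E]
    [NormedAddCommGroup F] {g : E → F} {L : NNReal} {R : ℝ} (hR : 0 ≤ R)
    (hg : LipschitzOnWith L g (closedBall 0 R)) (h0 : ∀ x, ‖x‖ = R → g x = 0) :
    LipschitzWith L ((closedBall (0 : E) R).indicator g) := by
  have key : ∀ x y : E, ‖x‖ ≤ R → R < ‖y‖ → ‖g x‖ ≤ L * dist x y := by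
    intro x y hx hy
    obtain ⟨u, hu, hxu⟩ : ∃ u : E, ‖u‖ = 1 ∧ x = ‖x‖ • u := by
      by_cases hx0 : x = 0
      · exact ⟨‖y‖⁻¹ • y, norm_smul_inv_norm (norm_pos_iff.1 (hR.trans_lt hy)), by simp [hx0]⟩
      · exact ⟨‖x‖⁻¹ • x, norm_smul_inv_norm hx0, by simp [smul_smul, hx0]⟩
    have hz : ‖R • u‖ = R := by rw [norm_smul, hu, Real.norm_of_nonneg hR, mul_one]
    have h := hg.dist_le_mul x (by simpa using hx) (R • u) (by simp [hz])
    rw [h0 _ hz, dist_zero_right] at h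
    refine h.trans (mul_le_mul_of_nonneg_left ?_ L.2)
    have h1 : dist x (R • u) = R - ‖x‖ := by
      conv_lhs => rw [hxu]
      rw [dist_eq_norm, ← sub_smul, norm_smul, hu, mul_one, Real.norm_eq_abs, abs_sub_comm,
        abs_of_nonneg (by linarith)]
    have h2 := norm_sub_norm_le y x
    rw [h1, dist_comm, dist_eq_norm]
    linarith
  refine LipschitzWith.of_dist_le_mul fun x y => ?_
  by_cases hx : ‖x‖ ≤ R <;> by_cases hy : ‖y‖ ≤ R
  · simpa [Set.indicator, hx, hy] using hg.dist_le_mul x (by simpa using hx) y (by simpa using hy)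
  · simpa [Set.indicator, hx, hy] using key x y hx (not_le.1 hy)
  · simpa [Set.indicator, hx, hy, dist_comm] using key y x hy (not_le.1 hx)
  · simp only [Set.indicator, mem_closedBall, dist_zero_right, hx, hy, if_false, dist_self]
    positivity

/-- A perturbation of the identity by a contraction is bijective. -/
lemma LipschitzWith.bijective_id_add {E : Type*} [NormedAddCommGroup E] [CompleteSpace E]
    {h : E → E} {K : NNReal} (hh : LipschitzWith K h) (hK : K < 1) :
    Function.Bijective fun x => x + h x := by
  constructor
  · intro x y hxy
    have h1 := hh.dist_le_mul x y
    have h2 : dist x y = dist (h x) (h y) := by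
      rw [dist_eq_norm, dist_eq_norm, ← norm_neg (h x - h y)]
      congr 1
      have : x + h x = y + h y := hxy
      rw [neg_sub, sub_eq_sub_iff_add_eq_add, this, add_comm]
    have hK' : (K : ℝ) < 1 := hK
    have h3 : dist x y ≤ 0 := by nlinarith [dist_nonneg (x := x) (y := y)]
    exact dist_le_zero.1 h3
  · intro y
    have hc : ContractingWith K fun x => y - h x :=
      ⟨hK, LipschitzWith.of_dist_le_mul fun a b => by
        simpa only [dist_sub_left] using hh.dist_le_mul a b⟩
    refine ⟨hc.fixedPoint, ?_⟩
    have := hc.fixedPoint_isFixedPt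
    rw [Function.IsFixedPt] at this
    exact (sub_eq_iff_eq_add.1 this).symm

open scoped RealInnerProductSpace in
/-- The derivative of a map whose values locally have constant nonzero norm is singular. -/
lemma HasFDerivAt.det_eq_zero_of_eventually_norm_eq {E : Type*} [NormedAddCommGroup E]
    [InnerProductSpace ℝ E] [FiniteDimensional ℝ E] {r : E → E} {r' : E →L[ℝ] E} {x : E} {R : ℝ}
    (hr : HasFDerivAt r r' x) (hR : 0 < R) (hnorm : ∀ᶠ y in nhds x, ‖r y‖ = R) : r'.det = 0 := by
  by_contra hdet
  have hsurj : Function.Surjective r' :=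
    (LinearEquiv.ofIsUnitDet (f := (r' : E →ₗ[ℝ] E)) (v := Module.finBasis ℝ E)
      (v' := Module.finBasis ℝ E)
      (by rw [LinearMap.det_toMatrix]; exact isUnit_iff_ne_zero.2 hdet)).surjective
  obtain ⟨v, hv⟩ := hsurj (r x)
  have h1 : HasFDerivAt (fun y => ⟪r y, r y⟫) (0 : E →L[ℝ] ℝ) x := by
    refine (hasFDerivAt_const (R ^ 2) x).congr_of_eventuallyEq ?_
    filter_upwards [hnorm] with y hy
    rw [real_inner_self_eq_norm_sq, hy]
  have h2 := congrArg (fun A : E →L[ℝ] ℝ => A v) ((hr.inner ℝ hr).unique h1)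
  simp [hv, hnorm.self_of_nhds, hR.ne'] at h2

open Metric MeasureTheory in
/-- There is no `C¹` retraction of a ball onto its boundary sphere. -/
lemma ContDiff.not_retraction_sphere {E : Type*} [NormedAddCommGroup E] [InnerProductSpace ℝ E]
    [FiniteDimensional ℝ E] {r : E → E} {R : ℝ} (hr : ContDiff ℝ 1 r) (hR : 0 < R)
    (hid : ∀ x, ‖x‖ = R → r x = x) (hnorm : ∀ x, ‖x‖ ≤ R → ‖r x‖ = R) : False := by
  borelize E
  let g : E → E := fun x => r x - x
  have hg : ContDiff ℝ 1 g := hr.sub contDiff_id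
  obtain ⟨L, hL⟩ := hg.contDiffOn.exists_lipschitzOnWith one_ne_zero (convex_closedBall (0 : E) R)
    (isCompact_closedBall 0 R)
  have hlip := hL.indicator_closedBall hR.le fun x hx => sub_eq_zero.2 (hid x hx)
  set G := (closedBall (0 : E) R).indicator g with hG
  let A : E → E →L[ℝ] E := fun x => fderiv ℝ g x
  have hA : Continuous A := hg.continuous_fderiv one_ne_zero
  have hderiv : ∀ x ∈ ball (0 : E) R, HasFDerivAt G (A x) x := fun x hx =>
    ((hg.differentiable one_ne_zero) x).hasFDerivAt.congr_of_eventuallyEq <| by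
      filter_upwards [isOpen_ball.mem_nhds hx] with y hy
      exact Set.indicator_of_mem (ball_subset_closedBall hy) g
  have hAdet : ∀ t : ℝ, Continuous fun x => (1 + t • A x).det := fun t =>
    ContinuousLinearMap.continuous_det.comp (by fun_prop)
  have hint : ∀ t : ℝ, IntegrableOn (fun x => (1 + t • A x).det) (ball (0 : E) R) := fun t =>
    ((hAdet t).continuousOn.integrableOn_compact (isCompact_closedBall 0 R)).mono_set
      ball_subset_closedBall
  have hpos : ∃ δ > 0, ∀ t : ℝ, 0 ≤ t → t < δ →
      t * L < 1 ∧ ∀ x ∈ ball (0 : E) R, 0 < (1 + t • A x).det := by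
    have hone : (1 : E →L[ℝ] E).det = 1 := by simp [ContinuousLinearMap.det]
    have hnhds : {B : E →L[ℝ] E | 0 < B.det} ∈ nhds 1 :=
      (isOpen_lt continuous_const ContinuousLinearMap.continuous_det).mem_nhds (by simp [hone])
    obtain ⟨η, hη, hball⟩ := Metric.mem_nhds_iff.1 hnhds
    have hL0 : (0 : ℝ) < L + 1 := by positivity
    refine ⟨min 1 η / (L + 1), by positivity, fun t ht0 ht => ?_⟩
    rw [lt_div_iff₀ hL0, lt_min_iff] at ht
    have htL : t * L ≤ t * (L + 1) := by nlinarith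
    refine ⟨by linarith, fun x hx => hball ?_⟩
    have hAx : ‖A x‖ ≤ L := (hderiv x hx).le_of_lipschitz hlip
    rw [mem_ball, dist_eq_norm, add_sub_cancel_left, norm_smul, Real.norm_of_nonneg ht0]
    exact (mul_le_mul_of_nonneg_left hAx ht0).trans_lt (by linarith)
  obtain ⟨δ, hδ, hδ'⟩ := hpos
  have hvol : ∀ t : ℝ, 0 ≤ t → t < δ →
      ∫ x in ball (0 : E) R, (1 + t • A x).det = volume.real (ball (0 : E) R) := by
    intro t ht0 ht
    obtain ⟨htL, hdet⟩ := hδ' t ht0 ht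
    let f : E → E := fun x => x + t • G x
    have hbij : Function.Bijective f := by
      refine LipschitzWith.bijective_id_add (K := t.toNNReal * L)
        (LipschitzWith.of_dist_le_mul fun x y => ?_)
        (by rwa [← NNReal.coe_lt_coe, NNReal.coe_mul, Real.coe_toNNReal t ht0])
      rw [dist_smul₀, Real.norm_of_nonneg ht0, NNReal.coe_mul, Real.coe_toNNReal t ht0, mul_assoc]
      exact mul_le_mul_of_nonneg_left (hlip.dist_le_mul x y) ht0
    have hout : ∀ x, x ∉ ball (0 : E) R → f x = x := by
      intro x hx
      have hGx : G x = 0 := by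
        by_cases h : x ∈ closedBall (0 : E) R
        · have hxR : ‖x‖ = R := by
            simp only [mem_ball, mem_closedBall, dist_zero_right, not_lt] at h hx
            exact le_antisymm h hx
          rw [hG, Set.indicator_of_mem h]
          exact sub_eq_zero.2 (hid x hxR)
        · exact Set.indicator_of_notMem h g
      simp [f, hGx]
    have himage : f '' ball (0 : E) R = ball (0 : E) R := by
      have hcompl : f '' (ball (0 : E) R)ᶜ = (ball (0 : E) R)ᶜ :=
        (Set.image_congr hout).trans (Set.image_id' _)
      rw [Set.image_compl_eq hbij] at hcompl
      exact compl_injective hcompl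
    have h := integral_image_eq_integral_abs_det_fderiv_smul volume measurableSet_ball
      (f := f) (f' := fun x => 1 + t • A x)
      (fun x hx => ((hasFDerivAt_id x).add ((hderiv x hx).const_smul t)).hasFDerivWithinAt)
      hbij.injective.injOn (fun _ => (1 : ℝ))
    rw [himage] at h
    rw [setIntegral_congr_fun (g := fun x => |(1 + t • A x).det| • (1 : ℝ)) measurableSet_ball
      fun x hx => by simp [abs_of_pos (hdet x hx)], ← h]
    simp
  obtain ⟨t, c, ht, hc⟩ := exists_extrapolation_nodes (Module.finrank ℝ E) hδ
  have hsum : ∑ k, c k = 1 := by simpa using (hc 1 (by simp)).symm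
  have hzero : ∀ x ∈ ball (0 : E) R, ∑ k, c k * (1 + t k • A x).det = 0 := by
    intro x hx
    obtain ⟨p, hp, hp'⟩ := (A x).exists_polynomial_eval_eq_det_one_add_smul
    simp_rw [hp', ← hc p hp, ← hp', one_smul]
    have hrx : HasFDerivAt r (1 + A x) x := by
      have h := (hasFDerivAt_id x).add ((hg.differentiable one_ne_zero) x).hasFDerivAt
      refine h.congr_of_eventuallyEq (Filter.Eventually.of_forall fun y => ?_)
      simp [g]
    refine hrx.det_eq_zero_of_eventually_norm_eq hR ?_
    filter_upwards [isOpen_ball.mem_nhds hx] with y hy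
    exact hnorm y (by simpa using ball_subset_closedBall hy)
  have hfinal : volume.real (ball (0 : E) R) = 0 :=
    calc volume.real (ball (0 : E) R)
        = ∑ k, c k * ∫ x in ball (0 : E) R, (1 + t k • A x).det := by
          simp_rw [hvol _ (ht _).1 (ht _).2, ← Finset.sum_mul, hsum, one_mul]
      _ = ∫ x in ball (0 : E) R, ∑ k, c k * (1 + t k • A x).det := by
          rw [integral_finsetSum _ fun k _ => (hint (t k)).const_mul (c k)]
          simp_rw [integral_const_mul]
      _ = 0 := setIntegral_eq_zero_of_forall_eq_zero hzero
  have hne : 0 < volume.real (ball (0 : E) R) :=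
    ENNReal.toReal_pos (measure_ball_pos volume 0 hR).ne' measure_ball_lt_top.ne
  exact hne.ne' hfinal

open Metric in
open scoped Manifold ContDiff in
/-- **Brouwer's fixed point theorem** for bounded continuous self-maps of a Euclidean space. -/
lemma Continuous.exists_fixedPoint_of_norm_le {E : Type*} [NormedAddCommGroup E]
    [InnerProductSpace ℝ E] [FiniteDimensional ℝ E] {f : E → E} {R : ℝ} (hf : Continuous f)
    (hR : ∀ x, ‖f x‖ ≤ R) : ∃ x, f x = x := by
  by_contra! hne
  have hR0 : 0 ≤ R := (norm_nonneg _).trans (hR 0)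
  obtain ⟨F, hF⟩ := exists_contMDiffMap_forall_mem_convex_of_local_const (n := 1) 𝓘(ℝ, E)
    (t := fun x => ball (f x) (dist (f x) x) ∩ closedBall 0 R)
    (fun x => (convex_ball _ _).inter (convex_closedBall _ _)) fun x => by
      refine ⟨f x, ?_⟩
      have h : ∀ᶠ y in nhds x, dist (f x) (f y) < dist (f y) y :=
        (isOpen_lt (by fun_prop) (by fun_prop)).mem_nhds (by simpa using hne x)
      filter_upwards [h] with y hy
      exact ⟨hy, by simpa using hR x⟩
  have hFsmooth : ContDiff ℝ 1 F := F.contMDiff.contDiff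
  have hFne : ∀ x, F x ≠ x := fun x hx => by
    have h := (hF x).1
    rw [hx, mem_ball, dist_comm] at h
    exact lt_irrefl _ h
  have hFR : ∀ x, ‖F x‖ ≤ R := fun x => by simpa using (hF x).2
  let θ : ContDiffBump (0 : E) := ⟨R + 1, R + 2, by linarith, by linarith⟩
  let Φ : E → E := fun x => x - θ x • F x
  have hΦ : ContDiff ℝ 1 Φ := contDiff_id.sub (θ.contDiff.smul hFsmooth)
  have hΦne : ∀ x, Φ x ≠ 0 := by
    intro x hx
    have hx' : x = θ x • F x := sub_eq_zero.1 hx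
    have hxR : ‖x‖ ≤ R := by
      rw [hx', norm_smul, Real.norm_of_nonneg θ.nonneg]
      exact (mul_le_of_le_one_left (norm_nonneg _) θ.le_one).trans (hFR x)
    have hθ : θ x = 1 := θ.one_of_mem_closedBall (by
      rw [mem_closedBall, dist_zero_right]; exact hxR.trans (by simp [θ]))
    rw [hθ, one_smul] at hx'
    exact hFne x hx'.symm
  have hpos : 0 < R + 2 := by linarith
  refine ContDiff.not_retraction_sphere (r := fun x => ((R + 2) * ‖Φ x‖⁻¹) • Φ x) (R := R + 2)
    ((contDiff_const.mul ((hΦ.norm ℝ hΦne).inv fun x => norm_ne_zero_iff.2 (hΦne x))).smul hΦ)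
    hpos (fun x hx => ?_) (fun x _ => ?_)
  · have hθ : θ x = 0 := θ.zero_of_le_dist (by simp [hx, θ])
    have hΦx : Φ x = x := by simp [Φ, hθ]
    simp only [hΦx, hx, mul_inv_cancel₀ hpos.ne', one_smul]
  · rw [norm_smul, norm_mul, norm_inv, norm_norm, mul_assoc,
      inv_mul_cancel₀ (norm_ne_zero_iff.2 (hΦne x)), mul_one, Real.norm_of_nonneg hpos.le]

/-- **Brouwer's fixed point theorem** for the standard simplex. -/
lemma stdSimplex.exists_fixedPoint {ι : Type*} [Fintype ι] [Nonempty ι]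
    {f : (ι → ℝ) → ι → ℝ} (hf : ContinuousOn f (stdSimplex ℝ ι))
    (hmaps : Set.MapsTo f (stdSimplex ℝ ι) (stdSimplex ℝ ι)) : ∃ x ∈ stdSimplex ℝ ι, f x = x := by
  let s : (ι → ℝ) → ℝ := fun x => ∑ i, max (x i) 0
  let r : (ι → ℝ) → ι → ℝ := fun x i =>
    (max (x i) 0 + max (1 - s x) 0 / Fintype.card ι) / max (s x) 1
  have hcard : (Fintype.card ι : ℝ) ≠ 0 := by simp
  have hs : Continuous s := by fun_prop
  have hmax : ∀ x, 0 < max (s x) 1 := fun x => lt_max_of_lt_right one_pos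
  have hr : Continuous r := continuous_pi fun i =>
    Continuous.div (by fun_prop) (by fun_prop) fun x => (hmax x).ne'
  have hrmem : ∀ x, r x ∈ stdSimplex ℝ ι := by
    intro x
    refine ⟨fun i => by positivity, ?_⟩
    simp only [r]
    rw [← Finset.sum_div, Finset.sum_add_distrib, div_eq_one_iff_eq (hmax x).ne']
    simp only [Finset.sum_const, Finset.card_univ, nsmul_eq_mul, mul_div_cancel₀ _ hcard]
    change s x + _ = _
    rcases le_total (s x) 1 with h | h
    · rw [max_eq_left (by linarith), max_eq_right h]; ring
    · rw [max_eq_right (by linarith), max_eq_left h]; ring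
  have hrid : ∀ x ∈ stdSimplex ℝ ι, r x = x := by
    intro x hx
    have hsx : s x = 1 := by
      simp only [s, max_eq_left (hx.1 _), hx.2]
    ext i
    simp [r, hsx, hx.1 i]
  let e := EuclideanSpace.equiv ι ℝ
  have hcont : Continuous fun y : EuclideanSpace ℝ ι => e.symm (f (r (e y))) :=
    e.symm.continuous.comp
      (hf.comp_continuous (hr.comp e.continuous) fun y => hrmem _)
  obtain ⟨R, hR⟩ := ((isCompact_stdSimplex ℝ ι).image e.symm.continuous).isBounded.exists_norm_le
  obtain ⟨y, hy⟩ := hcont.exists_fixedPoint_of_norm_le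
    fun y => hR _ (Set.mem_image_of_mem _ (hmaps (hrmem _)))
  have hy' : f (r (e y)) = e y := by simpa using congrArg e hy
  have hmem : e y ∈ stdSimplex ℝ ι := hy' ▸ hmaps (hrmem _)
  exact ⟨e y, hmem, by rwa [hrid _ hmem] at hy'⟩

open Metric in
/-- An upper semicontinuous map with convex values whose range is relatively compact in `D` has
approximate fixed points. -/
lemma exists_approx_fixedPoint_of_upperSemicontinuous
    {X : Type*} [NormedAddCommGroup X] [NormedSpace ℝ X]
    {D : Set X} (hne : D.Nonempty) (hclosed : IsClosed D) (hconv : Convex ℝ D) {G : X → Set X}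
    (hvals : ∀ x ∈ D, (G x).Nonempty ∧ Convex ℝ (G x) ∧ G x ⊆ D)
    (husc : ∀ x ∈ D, ∀ U : Set X, IsOpen U → G x ⊆ U →
      ∃ V ∈ nhds x, ∀ y ∈ V ∩ D, G y ⊆ U)
    (hcpt : IsCompact (closure (⋃ x ∈ D, G x))) {ε : ℝ} (hε : 0 < ε) :
    ∃ x ∈ D, ∃ y ∈ G x, dist x y < ε := by
  obtain ⟨η, hη, hηε⟩ : ∃ η > 0, 3 * η ≤ ε := ⟨ε / 3, by positivity, by linarith⟩
  set K := closure (⋃ x ∈ D, G x)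
  have hGK : ∀ x ∈ D, G x ⊆ K := fun x hx =>
    (Set.subset_biUnion_of_mem (u := G) hx).trans subset_closure
  have hKD : K ⊆ D := closure_minimal (Set.iUnion₂_subset fun x hx => (hvals x hx).2.2) hclosed
  obtain ⟨N, hNK, hN, hcover⟩ := hcpt.finite_cover_balls hη
  have := hN.fintype
  classical
  let φ : (N → ℝ) → X := fun t => ∑ i, t i • (i : X)
  have hφ : Continuous φ := by fun_prop
  have hφD : ∀ t ∈ stdSimplex ℝ N, φ t ∈ D := fun t ht =>
    hconv.sum_mem (fun i _ => ht.1 i) ht.2 fun i _ => hKD (hNK i.2)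
  have hlocal : ∀ x ∈ D, ∃ δ > 0, δ ≤ η ∧ ∀ y ∈ D, dist y x < 2 * δ →
      G y ⊆ thickening η (G x) := by
    intro x hx
    obtain ⟨V, hV, hVG⟩ := husc x hx _ isOpen_thickening (self_subset_thickening hη (G x))
    obtain ⟨ρ, hρ, hρV⟩ := Metric.mem_nhds_iff.1 hV
    refine ⟨min η (ρ / 2), by positivity, min_le_left _ _, fun y hy hyx => hVG y ⟨hρV ?_, hy⟩⟩
    rw [mem_ball]
    linarith [min_le_right η (ρ / 2)]
  choose! δ hδ hδη hδG using hlocal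
  have hC : IsCompact (φ '' stdSimplex ℝ N) := (isCompact_stdSimplex ℝ N).image hφ
  obtain ⟨T, hTC, hTcover⟩ := hC.elim_nhds_subcover (fun x => ball x (δ x)) (by
    rintro _ ⟨t, ht, rfl⟩
    exact ball_mem_nhds _ (hδ _ (hφD t ht)))
  have hTD : ∀ x ∈ T, x ∈ D := fun x hx => by
    obtain ⟨t, ht, rfl⟩ := hTC x hx
    exact hφD t ht
  have hchoice : ∀ x ∈ D, ∃ i : N, ∃ z ∈ G x, dist z i < η := fun x hx => by
    obtain ⟨z, hz⟩ := (hvals x hx).1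
    obtain ⟨i, hi, hzi⟩ := Set.mem_iUnion₂.1 (hcover (hGK x hx hz))
    exact ⟨⟨i, hi⟩, z, hz, hzi⟩
  obtain ⟨x₀, hx₀⟩ := hne
  have : Nonempty N := ⟨(hchoice x₀ hx₀).choose⟩
  choose! i z hz hzi using hchoice
  let w : X → X → ℝ := fun x y => max (δ x - dist y x) 0
  have hw : ∀ x, Continuous (w x) := fun x => by fun_prop
  have hw0 : ∀ x y, 0 ≤ w x y := fun x y => le_max_right _ _
  have hwpos : ∀ {x y}, w x y ≠ 0 → dist y x < δ x := fun {x y} h => by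
    by_contra! h'
    exact h (max_eq_right (by linarith))
  let W : X → ℝ := fun y => ∑ x ∈ T, w x y
  have hW : ∀ t ∈ stdSimplex ℝ N, 0 < W (φ t) := by
    intro t ht
    obtain ⟨x, hx, hxt⟩ := Set.mem_iUnion₂.1 (hTcover (Set.mem_image_of_mem φ ht))
    rw [mem_ball] at hxt
    exact Finset.sum_pos' (fun _ _ => hw0 _ _) ⟨x, hx, lt_max_of_lt_left (by linarith)⟩
  let f : (N → ℝ) → N → ℝ := fun t => ∑ x ∈ T, (w x (φ t) / W (φ t)) • Pi.single (i x) 1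
  have hweights : ∀ t ∈ stdSimplex ℝ N, ∑ x ∈ T, w x (φ t) / W (φ t) = 1 := fun t ht => by
    rw [← Finset.sum_div, div_self (hW t ht).ne']
  have hf : ContinuousOn f (stdSimplex ℝ N) := by
    refine continuousOn_finsetSum _ fun x _ => ContinuousOn.fun_smul ?_ continuousOn_const
    exact ((hw x).comp hφ).continuousOn.div
      (continuous_finsetSum _ fun x _ => (hw x).comp hφ).continuousOn fun t ht => (hW t ht).ne'
  have hmaps : Set.MapsTo f (stdSimplex ℝ N) (stdSimplex ℝ N) := fun t ht =>
    (convex_stdSimplex ℝ N).sum_mem (fun x _ => div_nonneg (hw0 _ _) (hW t ht).le)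
      (hweights t ht) fun x _ => single_mem_stdSimplex ℝ (i x)
  obtain ⟨t, ht, hft⟩ := stdSimplex.exists_fixedPoint hf hmaps
  have hsum : φ t = ∑ x ∈ T, (w x (φ t) / W (φ t)) • (i x : X) := by
    have hφlin : ∀ a : X → ℝ, φ (∑ x ∈ T, a x • Pi.single (i x) 1) = ∑ x ∈ T, a x • (i x : X) := by
      intro a
      simp only [φ, Finset.sum_apply, Pi.smul_apply, Finset.sum_smul]
      rw [Finset.sum_comm]
      refine Finset.sum_congr rfl fun x _ => ?_
      simp [Pi.single_apply]
    conv_lhs => rw [← hft]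
    exact hφlin _
  set p := φ t
  have hpD : p ∈ D := hφD t ht
  let S := T.filter fun x => w x p ≠ 0
  have hS : S.Nonempty := by
    by_contra h
    rw [Finset.not_nonempty_iff_eq_empty, Finset.filter_eq_empty_iff] at h
    exact (hW t ht).ne' (Finset.sum_eq_zero fun x hx => not_not.1 (h hx))
  obtain ⟨m, hmS, hmax⟩ := S.exists_max_image δ hS
  obtain ⟨hmT, hm⟩ := Finset.mem_filter.1 hmS
  have hmD := hTD m hmT
  have hmem : p ∈ thickening (2 * η) (G m) := by
    have hconvex : Convex ℝ (thickening (2 * η) (G m)) := (hvals m hmD).2.1.thickening _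
    rw [hsum, ← Finset.sum_filter_of_ne (p := fun x => w x p ≠ 0)
      fun x _ hx h0 => hx (by simp [h0])]
    refine hconvex.sum_mem (fun x _ => div_nonneg (hw0 _ _) (hW t ht).le) ?_ fun x hx => ?_
    · rw [Finset.sum_filter_of_ne (p := fun x => w x p ≠ 0) fun x _ hx h0 => hx (by simp [h0])]
      exact hweights t ht
    · obtain ⟨hxT, hx0⟩ := Finset.mem_filter.1 hx
      have hxD := hTD x hxT
      have hxm : dist x m < 2 * δ m := by
        have h1 := hwpos hx0
        have h2 := hwpos hm
        have h3 := hmax x hx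
        have h4 := dist_triangle_left x m p
        linarith
      obtain ⟨y, hy, hyz⟩ := mem_thickening_iff.1 (hδG m hmD x hxD hxm (hz x hxD))
      refine mem_thickening_iff.2 ⟨y, hy, ?_⟩
      have h5 := hzi x hxD
      have h6 := dist_triangle_left (i x : X) y (z x)
      linarith
  obtain ⟨y, hy, hyp⟩ := mem_thickening_iff.1 hmem
  refine ⟨m, hmD, y, hy, ?_⟩
  have h1 := (hwpos hm).trans_le (hδη m hmD)
  have h2 := dist_triangle_left m y p
  linarith

theorem bohnenblust_karlin
    {X : Type*} [NormedAddCommGroup X] [NormedSpace ℝ X]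
    (D : Set X) (hne : D.Nonempty) (hbdd : Bornology.IsBounded D)
    (hclosed : IsClosed D) (hconv : Convex ℝ D)
    (G : X → Set X)
    (hvals : ∀ x ∈ D, (G x).Nonempty ∧ IsClosed (G x) ∧ Convex ℝ (G x) ∧ G x ⊆ D)
    (husc : ∀ x ∈ D, ∀ U : Set X, IsOpen U → G x ⊆ U →
      ∃ V ∈ nhds x, ∀ y ∈ V ∩ D, G y ⊆ U)
    (hcpt : IsCompact (closure (⋃ x ∈ D, G x))) :
    ∃ x ∈ D, x ∈ G x := by
  have hGD : ∀ x ∈ D, (G x).Nonempty ∧ Convex ℝ (G x) ∧ G x ⊆ D := fun x hx =>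
    ⟨(hvals x hx).1, (hvals x hx).2.2⟩
  choose x hx y hy hxy using fun n : ℕ =>
    exists_approx_fixedPoint_of_upperSemicontinuous hne hclosed hconv hGD husc hcpt
      (Nat.one_div_pos_of_nat (α := ℝ) (n := n))
  obtain ⟨p, hp, σ, hσ, hyp⟩ := hcpt.tendsto_subseq fun n =>
    subset_closure (Set.mem_biUnion (hx n) (hy n))
  have hpD : p ∈ D :=
    closure_minimal (Set.iUnion₂_subset fun x hx => (hGD x hx).2.2) hclosed hp
  have hxp : Filter.Tendsto (fun n => x (σ n)) Filter.atTop (nhds p) := by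
    refine (tendsto_iff_of_dist ?_).2 hyp
    exact squeeze_zero (fun _ => dist_nonneg) (fun n => (hxy (σ n)).le)
      (tendsto_one_div_add_atTop_nhds_zero_nat.comp hσ.tendsto_atTop)
  refine ⟨p, hpD, ?_⟩
  rw [← (hvals p hpD).2.1.closure_eq, Metric.closure_eq_iInter_cthickening]
  refine Set.mem_iInter₂.2 fun ε hε => ?_
  obtain ⟨V, hV, hVG⟩ := husc p hpD _ Metric.isOpen_thickening
    (Metric.self_subset_thickening hε (G p))
  refine Metric.isClosed_cthickening.mem_of_tendsto hyp ?_
  filter_upwards [hxp hV] with n hn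
  exact Metric.thickening_subset_cthickening _ _ (hVG _ ⟨hn, hx _⟩ (hy _))
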